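/- The closure of a visually symmetric subset of the ideal boundary of a locally compact, geodesically complete CAT(0) space is symmetric. -/

import Mathlib

open Real Set Filter Metric
open scoped ENNReal

noncomputable section

variable {X : Type*} [MetricSpace X]

/-- `γ` restricted to `[a,b]` is a unit-speed geodesic. -/
def IsGeodesicOn (γ : ℝ → X) (a b : ℝ) : Prop :=
  ∀ s ∈ Set.Icc a b, ∀ t ∈ Set.Icc a b, dist (γ s) (γ t) = |s - t|

/-- A geodesic from `x` to `y` parametrized by arclength on `[0, dist x y]`. -/
def GeodesicBetween (γ : ℝ → X) (x y : X) : Prop :=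
  γ 0 = x ∧ γ (dist x y) = y ∧ IsGeodesicOn γ 0 (dist x y)

/-- A complete geodesic (line). -/
def IsGeodesicLine (c : ℝ → X) : Prop := ∀ s t : ℝ, dist (c s) (c t) = |s - t|

/-- A geodesic ray (unit speed, defined on `[0,∞)`). -/
def IsGeodesicRay (c : ℝ → X) : Prop :=
  ∀ s t : ℝ, 0 ≤ s → 0 ≤ t → dist (c s) (c t) = |s - t|

/-- A CAT(0) space: geodesic and satisfying the CN (Bruhat–Tits) comparison
inequality. -/
class CAT0 (X : Type*) [MetricSpace X] : Prop where
  geodesic : ∀ x y : X, ∃ γ : ℝ → X, GeodesicBetween γ x y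
  cn : ∀ x y z m : X, dist y m = dist y z / 2 → dist z m = dist y z / 2 →
    dist x m ^ 2 ≤ (dist x y ^ 2 + dist x z ^ 2) / 2 - dist y z ^ 2 / 4

/-- Geodesic completeness: every nondegenerate geodesic segment extends to a complete
geodesic. -/
def GeodesicallyComplete (X : Type*) [MetricSpace X] : Prop :=
  ∀ (γ : ℝ → X) (x y : X), GeodesicBetween γ x y → x ≠ y →
    ∃ c : ℝ → X, IsGeodesicLine c ∧ ∀ t ∈ Set.Icc (0 : ℝ) (dist x y), c t = γ t

/-- A *Hadamard space*: a locally compact, complete, geodesically complete CAT(0)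
space. -/
def IsHadamard (X : Type*) [MetricSpace X] : Prop :=
  CAT0 X ∧ LocallyCompactSpace X ∧ CompleteSpace X ∧ GeodesicallyComplete X

/-- `X` has cocompact isometry group. -/
def CocompactIsom (X : Type*) [MetricSpace X] : Prop :=
  ∃ K : Set X, IsCompact K ∧ ∀ x : X, ∃ g : X ≃ᵢ X, g x ∈ K

/-- The space of geodesic rays of `X`. -/
def Ray (X : Type*) [MetricSpace X] := {c : ℝ → X // IsGeodesicRay c}

/-- Two rays are asymptotic if they are at bounded distance. -/
def asymptotic (c c' : Ray X) : Prop :=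
  ∃ K : ℝ, ∀ t : ℝ, 0 ≤ t → dist (c.1 t) (c'.1 t) ≤ K

def raySetoid (X : Type*) [MetricSpace X] : Setoid (Ray X) where
  r := asymptotic
  iseqv := by
    constructor
    · exact fun c => ⟨0, fun t _ => by simp⟩
    · rintro c c' ⟨K, hK⟩
      exact ⟨K, fun t ht => by rw [dist_comm]; exact hK t ht⟩
    · rintro c c' c'' ⟨K, hK⟩ ⟨K', hK'⟩
      exact ⟨K + K', fun t ht =>
        (dist_triangle _ (c'.1 t) _).trans (add_le_add (hK t ht) (hK' t ht))⟩

/-- The ideal boundary `∂_∞ X`: asymptote classes of geodesic rays. -/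
def IdealBoundary (X : Type*) [MetricSpace X] : Type _ := Quotient (raySetoid X)

/-- The ideal point determined by a geodesic ray. -/
def rayClass (c : Ray X) : IdealBoundary X := Quotient.mk (raySetoid X) c

/-- The forward ray of a complete geodesic. -/
def linePosRay (c : ℝ → X) (h : IsGeodesicLine c) : Ray X :=
  ⟨c, fun s t _ _ => h s t⟩

/-- The backward ray of a complete geodesic. -/
def lineNegRay (c : ℝ → X) (h : IsGeodesicLine c) : Ray X :=
  ⟨fun t => c (-t), fun s t _ _ => by
    have := h (-s) (-t)
    rwa [show (-s) - (-t) = t - s by ring, abs_sub_comm] at this⟩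

/-- The Tits angle between two ideal points: the limit of comparison angles between
representing rays issuing from a common basepoint. -/
noncomputable def titsAngle (ξ η : IdealBoundary X) : ℝ :=
  sSup {θ : ℝ | ∃ c c' : Ray X, rayClass c = ξ ∧ rayClass c' = η ∧ c.1 0 = c'.1 0 ∧
    Tendsto (fun t : ℝ => 2 * Real.arcsin (dist (c.1 t) (c'.1 t) / (2 * t)))
      atTop (nhds θ)}

/-- The length of a chain of ideal points, measured with the Tits angle. -/
noncomputable def chainLength (f : ℕ → IdealBoundary X) (n : ℕ) : ℝ≥0∞ :=
  ∑ i ∈ Finset.range n, ENNReal.ofReal (titsAngle (f i) (f (i + 1)))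

/-- The Tits metric on the ideal boundary: the intrinsic (length) metric associated to
the Tits angle, via infima over `ε`-fine chains. -/
noncomputable def titsDist (ξ η : IdealBoundary X) : ℝ≥0∞ :=
  ⨆ (ε : ℝ) (_ : 0 < ε), sInf {L : ℝ≥0∞ | ∃ (n : ℕ) (f : ℕ → IdealBoundary X),
    f 0 = ξ ∧ f n = η ∧ (∀ i < n, titsAngle (f i) (f (i + 1)) ≤ ε) ∧
    L = chainLength f n}

/-- Two ideal points are antipodal if their Tits distance is at least `π`. -/
def AntipodalB (ξ η : IdealBoundary X) : Prop := ENNReal.ofReal π ≤ titsDist ξ η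

/-- Two ideal points are visually antipodal if they are the two endpoints of a complete
geodesic in `X`. -/
def VisuallyAntipodal (ξ η : IdealBoundary X) : Prop :=
  ∃ (c : ℝ → X) (h : IsGeodesicLine c),
    rayClass (linePosRay c h) = ξ ∧ rayClass (lineNegRay c h) = η

/-- A subset of the ideal boundary is symmetric if it contains all antipodes of its
points. -/
def SymmetricSet (A : Set (IdealBoundary X)) : Prop :=
  ∀ ξ ∈ A, ∀ η, AntipodalB ξ η → η ∈ A

/-- A subset of the ideal boundary is symmetric w.r.t. geodesic lines if every complete
geodesic of `X` has both or neither of its ideal endpoints in it. -/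
def LineSymmetricSet (A : Set (IdealBoundary X)) : Prop :=
  ∀ (c : ℝ → X) (h : IsGeodesicLine c),
    (rayClass (linePosRay c h) ∈ A ↔ rayClass (lineNegRay c h) ∈ A)

/-- A subset is visually symmetric if it contains all visual antipodes of its points. -/
def VisuallySymmetricSet (A : Set (IdealBoundary X)) : Prop :=
  ∀ ξ ∈ A, ∀ η, VisuallyAntipodal ξ η → η ∈ A

/-- Convergence of a sequence of ideal points in the cone topology: representing rays
from a common basepoint converge pointwise. -/
def ConeConvB (ξ : ℕ → IdealBoundary X) (η : IdealBoundary X) : Prop :=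
  ∃ (c : ℕ → Ray X) (c' : Ray X), (∀ k, rayClass (c k) = ξ k) ∧ rayClass c' = η ∧
    (∀ k, (c k).1 0 = c'.1 0) ∧
    ∀ t : ℝ, 0 ≤ t → Tendsto (fun k => dist ((c k).1 t) (c'.1 t)) atTop (nhds 0)

/-- Sequential closure in the cone topology. -/
def coneClosure (A : Set (IdealBoundary X)) : Set (IdealBoundary X) :=
  A ∪ {η | ∃ ξ : ℕ → IdealBoundary X, (∀ k, ξ k ∈ A) ∧ ConeConvB ξ η}

/-- Sequential closedness in the cone topology. -/
def ConeClosed (A : Set (IdealBoundary X)) : Prop :=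
  ∀ (ξ : ℕ → IdealBoundary X) (η : IdealBoundary X),
    (∀ k, ξ k ∈ A) → ConeConvB ξ η → η ∈ A

/-- A minimal closed symmetric subset of the ideal boundary. -/
def MinimalClosedSymmetric (B : Set (IdealBoundary X)) : Prop :=
  B.Nonempty ∧ ConeClosed B ∧ SymmetricSet B ∧
    ∀ B' ⊆ B, B'.Nonempty → ConeClosed B' → SymmetricSet B' → B' = B

/-- Convergence of a sequence of points of `X` to an ideal point in the cone topology:
the distances to a basepoint blow up and the geodesics from the basepoint converge
pointwise to a ray representing the ideal point. -/
def ConeConvPt (o : X) (x : ℕ → X) (η : IdealBoundary X) : Prop :=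
  Tendsto (fun k => dist o (x k)) atTop atTop ∧
  ∃ (c : Ray X) (g : ℕ → ℝ → X), c.1 0 = o ∧ rayClass c = η ∧
    (∀ k, GeodesicBetween (g k) o (x k)) ∧
    ∀ t : ℝ, 0 ≤ t → Tendsto (fun k => dist (g k t) (c.1 t)) atTop (nhds 0)

/-- The image of a ray under an isometry of `X`. -/
def isomRay (g : X ≃ᵢ X) (c : Ray X) : Ray X :=
  ⟨fun t => g (c.1 t), fun s t hs ht => by
    rw [g.dist_eq]; exact c.2 s t hs ht⟩

/-- The induced map of an isometry of `X` on the ideal boundary. -/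
def isomBoundary (g : X ≃ᵢ X) : IdealBoundary X → IdealBoundary X :=
  Quotient.map' (isomRay g) (by
    rintro c c' ⟨K, hK⟩
    exact ⟨K, fun t ht => by simpa [isomRay, g.dist_eq] using hK t ht⟩)

/-- A submetry from the Tits boundary to a metric space. -/
def IsTitsSubmetry {Δ : Type*} [MetricSpace Δ] (δ : IdealBoundary X → Δ) : Prop :=
  Function.Surjective δ ∧ ∀ (ξ : IdealBoundary X) (r : ℝ), 0 ≤ r →
    δ '' {η | titsDist ξ η ≤ ENNReal.ofReal r} = Metric.closedBall (δ ξ) r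

open scoped RealInnerProductSpace

/-- Spherical (angular) distance between vectors. -/
noncomputable def sd {m : ℕ} (u v : EuclideanSpace ℝ (Fin m)) : ℝ := Real.arccos ⟪u, v⟫

/-- A subset of the Tits boundary is a round `k`-sphere if it admits a distance chart
onto the unit sphere `S^k ⊂ ℝ^{k+1}`. -/
def IsRoundSphereB (S : Set (IdealBoundary X)) (k : ℕ) : Prop :=
  ∃ f : IdealBoundary X → EuclideanSpace ℝ (Fin (k + 1)),
    (∀ p ∈ S, ‖f p‖ = 1) ∧
    (∀ v : EuclideanSpace ℝ (Fin (k + 1)), ‖v‖ = 1 → ∃ p ∈ S, f p = v) ∧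
    Set.InjOn f S ∧
    ∀ p ∈ S, ∀ q ∈ S, titsDist p q = ENNReal.ofReal (sd (f p) (f q))

/-- A round sphere of the Tits boundary is top-dimensional if no round sphere of larger
dimension exists. -/
def IsTopDimSphere (S : Set (IdealBoundary X)) (k : ℕ) : Prop :=
  IsRoundSphereB S k ∧ ∀ (S' : Set (IdealBoundary X)) (m : ℕ), IsRoundSphereB S' m → m ≤ k

/-- A subset `H` of the Tits boundary is a round `k`-hemisphere with boundary sphere
`bd` if it admits a distance chart onto a closed hemisphere of `S^k`, carrying `bd`
onto the equator. -/
def IsRoundHemisphereB (H : Set (IdealBoundary X)) (k : ℕ) (bd : Set (IdealBoundary X)) :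
    Prop :=
  ∃ f : IdealBoundary X → EuclideanSpace ℝ (Fin (k + 1)),
    (∀ p ∈ H, ‖f p‖ = 1 ∧ 0 ≤ f p (Fin.last k)) ∧
    (∀ v : EuclideanSpace ℝ (Fin (k + 1)), ‖v‖ = 1 → 0 ≤ v (Fin.last k) →
      ∃ p ∈ H, f p = v) ∧
    Set.InjOn f H ∧
    (∀ p ∈ H, ∀ q ∈ H, titsDist p q = ENNReal.ofReal (sd (f p) (f q))) ∧
    bd = {p ∈ H | f p (Fin.last k) = 0}


theorem aux_cat0_ineq [CAT0 X] (γ : ℝ → X) (b : ℝ) (hγ : IsGeodesicOn γ 0 b)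
    (x : X) (t : ℝ) (ht : t ∈ Set.Icc 0 b) :
    t * (dist x (γ 0) ^ 2 + b ^ 2 - dist x (γ b) ^ 2) ≤
      b * (dist x (γ 0) ^ 2 + t ^ 2 - dist x (γ t) ^ 2) := by
  have hb : 0 ≤ b := ht.1.trans ht.2
  obtain ⟨F, hF⟩ : ∃ F : ℝ → ℝ, ∀ t, F t = t * (dist x (γ 0) ^ 2 + b ^ 2 - dist x (γ b) ^ 2) -
      b * (dist x (γ 0) ^ 2 + t ^ 2 - dist x (γ t) ^ 2) := ⟨_, fun _ => rfl⟩
  have F0 : F 0 = 0 := by rw [hF]; ring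
  have Fb : F b = 0 := by rw [hF]; ring
  have mid : ∀ u ∈ Set.Icc 0 b, ∀ v ∈ Set.Icc 0 b, F ((u + v) / 2) ≤ (F u + F v) / 2 := by
    intro u hu v hv
    have hm : (u + v) / 2 ∈ Set.Icc 0 b :=
      ⟨by linarith [hu.1, hv.1], by linarith [hu.2, hv.2]⟩
    have h1 : dist (γ u) (γ ((u + v) / 2)) = dist (γ u) (γ v) / 2 := by
      rw [hγ u hu _ hm, hγ u hu v hv, show u - (u + v) / 2 = (u - v) / 2 by ring, abs_div]
      norm_num
    have h2 : dist (γ v) (γ ((u + v) / 2)) = dist (γ u) (γ v) / 2 := by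
      rw [hγ v hv _ hm, hγ u hu v hv, show v - (u + v) / 2 = -((u - v) / 2) by ring, abs_neg,
        abs_div]
      norm_num
    have h3 := CAT0.cn x (γ u) (γ v) _ h1 h2
    rw [hγ u hu v hv, sq_abs] at h3
    rw [hF, hF, hF]
    nlinarith [mul_le_mul_of_nonneg_left h3 hb]
  obtain ⟨C, hC0, hC⟩ : ∃ C : ℝ, 0 ≤ C ∧ ∀ t ∈ Set.Icc 0 b, F t ≤ C := by
    refine ⟨b * (dist x (γ 0) ^ 2 + b ^ 2) + b * (dist x (γ 0) + b) ^ 2, by positivity, ?_⟩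
    intro t ht
    have h1 : dist x (γ t) ≤ dist x (γ 0) + b := by
      have := dist_triangle x (γ 0) (γ t)
      rw [hγ 0 ⟨le_rfl, hb⟩ t ht, zero_sub, abs_neg, abs_of_nonneg ht.1] at this
      linarith [ht.2]
    have h2 : dist x (γ t) ^ 2 ≤ (dist x (γ 0) + b) ^ 2 := by gcongr
    have h3 : t * (dist x (γ 0) ^ 2 + b ^ 2 - dist x (γ b) ^ 2) ≤
        b * (dist x (γ 0) ^ 2 + b ^ 2) := by
      have : t * (dist x (γ 0) ^ 2 + b ^ 2) ≤ b * (dist x (γ 0) ^ 2 + b ^ 2) := by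
        gcongr; exact ht.2
      nlinarith [mul_nonneg ht.1 (sq_nonneg (dist x (γ b)))]
    rw [hF]
    have h4 := mul_le_mul_of_nonneg_left h2 hb
    have h5 : 0 ≤ b * (dist x (γ 0) ^ 2 + t ^ 2) := by positivity
    nlinarith
  have key : ∀ n : ℕ, ∀ t ∈ Set.Icc 0 b, F t ≤ C / 2 ^ n := by
    intro n
    induction n with
    | zero => simpa using hC
    | succ n ih =>
      intro t ht
      have e : C / 2 ^ (n + 1) = C / 2 ^ n / 2 := by rw [pow_succ]; field_simp
      rw [e]
      by_cases h : 2 * t ≤ b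
      · have hm : 2 * t ∈ Set.Icc 0 b := ⟨by linarith [ht.1], h⟩
        have := mid 0 ⟨le_rfl, hb⟩ (2 * t) hm
        rw [show (0 + 2 * t) / 2 = t by ring, F0] at this
        linarith [ih _ hm]
      · have hm : 2 * t - b ∈ Set.Icc 0 b := ⟨by linarith, by linarith [ht.2]⟩
        have := mid b ⟨hb, le_rfl⟩ (2 * t - b) hm
        rw [show (b + (2 * t - b)) / 2 = t by ring, Fb] at this
        linarith [ih _ hm]
  have lim : Tendsto (fun n : ℕ => C / 2 ^ n) atTop (nhds 0) := by
    have := (tendsto_pow_atTop_nhds_zero_of_lt_one (r := (1 / 2 : ℝ)) (by norm_num)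
      (by norm_num)).const_mul C
    simpa [div_eq_mul_inv] using this
  have : F t ≤ 0 := ge_of_tendsto' lim (fun n => key n t ht)
  rw [hF] at this
  linarith

/-- Two-sided comparison for a hinge. -/
theorem aux_hinge [CAT0 X] (γ γ' : ℝ → X) (a b : ℝ) (hγ : IsGeodesicOn γ 0 a)
    (hγ' : IsGeodesicOn γ' 0 b) (h0 : γ 0 = γ' 0) (s t : ℝ) (hs : s ∈ Set.Icc 0 a)
    (ht : t ∈ Set.Icc 0 b) :
    s * t * (a ^ 2 + b ^ 2 - dist (γ a) (γ' b) ^ 2) ≤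
      a * b * (s ^ 2 + t ^ 2 - dist (γ s) (γ' t) ^ 2) := by
  have ha : 0 ≤ a := hs.1.trans hs.2
  have hb : 0 ≤ b := ht.1.trans ht.2
  have h1 := aux_cat0_ineq γ a hγ (γ' b) s hs
  have h2 := aux_cat0_ineq γ' b hγ' (γ s) t ht
  have e1 : dist (γ' b) (γ 0) = b := by
    rw [h0, hγ' b ⟨hb, le_rfl⟩ 0 ⟨le_rfl, hb⟩, sub_zero, abs_of_nonneg hb]
  have e2 : dist (γ s) (γ' 0) = s := by
    rw [← h0, hγ s hs 0 ⟨le_rfl, ha⟩, sub_zero, abs_of_nonneg hs.1]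
  rw [e1, dist_comm _ (γ a), dist_comm _ (γ s)] at h1
  rw [e2] at h2
  have h3 := mul_le_mul_of_nonneg_left h1 ht.1
  have h4 := mul_le_mul_of_nonneg_left h2 ha
  nlinarith

theorem aux_hinge_prop [CAT0 X] (γ γ' : ℝ → X) (a b : ℝ) (ha : 0 < a) (hb : 0 < b)
    (hγ : IsGeodesicOn γ 0 a)
    (hγ' : IsGeodesicOn γ' 0 b) (h0 : γ 0 = γ' 0) (l : ℝ) (hl0 : 0 ≤ l) (hl1 : l ≤ 1) :
    dist (γ (l * a)) (γ' (l * b)) ≤ l * dist (γ a) (γ' b) := by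
  have h := aux_hinge γ γ' a b hγ hγ' h0 (l * a) (l * b) ⟨by positivity, by nlinarith⟩
    ⟨by positivity, by nlinarith⟩
  have h2 : a * b * dist (γ (l * a)) (γ' (l * b)) ^ 2 ≤ a * b * (l * dist (γ a) (γ' b)) ^ 2 := by
    nlinarith
  have h3 := le_of_mul_le_mul_left h2 (by positivity)
  exact le_of_sq_le_sq h3 (by positivity)

theorem aux_proper [CAT0 X] [LocallyCompactSpace X] [CompleteSpace X] : ProperSpace X := by
  refine ⟨fun o => ?_⟩
  -- a point of a ball can be moved towards the centre
  have move : ∀ (r δ : ℝ), 0 ≤ r → 0 ≤ δ → ∀ x ∈ closedBall o (r + δ),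
      ∃ y ∈ closedBall o r, dist x y ≤ δ := by
    intro r δ hr hδ x hx
    by_cases h : dist o x ≤ r
    · exact ⟨x, by rwa [mem_closedBall, dist_comm], by simpa using hδ⟩
    · push Not at h
      obtain ⟨γ, h0, h1, hg⟩ := CAT0.geodesic o x
      have hD : 0 ≤ dist o x := dist_nonneg
      rw [mem_closedBall, dist_comm] at hx
      refine ⟨γ r, ?_, ?_⟩
      · rw [mem_closedBall]
        have h2 := hg r ⟨hr, h.le⟩ 0 ⟨le_rfl, hD⟩
        rw [h0, sub_zero, abs_of_nonneg hr] at h2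
        exact h2.le
      · nth_rewrite 1 [← h1]
        rw [hg _ ⟨hD, le_rfl⟩ r ⟨hr, h.le⟩, abs_of_nonneg (by linarith)]
        linarith
  have mono : ∀ r r' : ℝ, r ≤ r' → IsCompact (closedBall o r') → IsCompact (closedBall o r) :=
    fun r r' h hc => hc.of_isClosed_subset isClosed_closedBall (closedBall_subset_closedBall h)
  have step : ∀ r : ℝ, 0 ≤ r → IsCompact (closedBall o r) →
      ∃ δ > 0, IsCompact (closedBall o (r + δ)) := by
    intro r hr hc
    obtain ⟨K, hK, hsub⟩ := exists_compact_superset hc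
    obtain ⟨δ, hδ, hth⟩ := hc.exists_cthickening_subset_open isOpen_interior hsub
    refine ⟨δ, hδ, hK.of_isClosed_subset isClosed_closedBall ?_⟩
    intro x hx
    obtain ⟨y, hy, hxy⟩ := move r δ hr hδ.le x hx
    exact interior_subset (hth (mem_cthickening_of_dist_le x y δ _ hy hxy))
  have lim : ∀ r : ℝ, 0 < r → (∀ r' < r, IsCompact (closedBall o r')) →
      IsCompact (closedBall o r) := by
    intro r hr hc
    refine TotallyBounded.isCompact_of_isClosed ?_ isClosed_closedBall
    rw [Metric.totallyBounded_iff]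
    intro ε hε
    set δ := min (ε / 2) (r / 2) with hδ
    have hδ0 : 0 < δ := by positivity
    have hδ1 : δ ≤ ε / 2 := min_le_left _ _
    have hδ2 : δ ≤ r / 2 := min_le_right _ _
    obtain ⟨T, hT, hcov⟩ := Metric.totallyBounded_iff.1 (hc (r - δ) (by linarith)).totallyBounded
      (ε / 2) (by positivity)
    refine ⟨T, hT, ?_⟩
    intro x hx
    obtain ⟨y, hy, hxy⟩ := move (r - δ) δ (by linarith) hδ0.le x (by simpa using hx)
    have := hcov hy
    simp only [mem_iUnion, mem_ball, exists_prop] at this ⊢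
    obtain ⟨z, hz, hyz⟩ := this
    exact ⟨z, hz, by linarith [dist_triangle x y z]⟩
  by_contra! hcon
  obtain ⟨r1, hr1⟩ := hcon
  have c0 : IsCompact (closedBall o 0) := by simp
  set S := {r : ℝ | 0 ≤ r ∧ IsCompact (closedBall o r)} with hS
  have hbdd : ∀ r ∈ S, r ≤ r1 := by
    intro r hr
    by_contra! h
    exact hr1 (mono _ _ h.le hr.2)
  have hB : BddAbove S := ⟨r1, hbdd⟩
  have h0S : (0 : ℝ) ∈ S := ⟨le_rfl, c0⟩
  have hs0 : 0 ≤ sSup S := le_csSup hB h0S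
  have hsc : IsCompact (closedBall o (sSup S)) := by
    rcases hs0.eq_or_lt with h | h
    · rw [← h]; exact c0
    · refine lim _ h (fun r' hr' => ?_)
      obtain ⟨r, hr, hlt⟩ := exists_lt_of_lt_csSup ⟨0, h0S⟩ hr'
      exact mono _ _ hlt.le hr.2
  obtain ⟨δ, hδ, hc⟩ := step _ hs0 hsc
  have : sSup S + δ ≤ sSup S := le_csSup hB ⟨by linarith, hc⟩
  linarith

theorem aux_ulim [ProperSpace X] (o : X) (R : ℝ) (x : ℕ → X)
    (h : ∀ᶠ n in (hyperfilter ℕ : Filter ℕ), dist (x n) o ≤ R) :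
    ∃ y, Tendsto x (hyperfilter ℕ : Filter ℕ) (nhds y) := by
  have hc := isCompact_closedBall o R
  obtain ⟨y, -, hy⟩ := hc.ultrafilter_le_nhds ((hyperfilter ℕ).map x) (by
    rw [Filter.le_principal_iff]
    exact h)
  exact ⟨y, hy⟩

theorem aux_hyper_le : (hyperfilter ℕ : Filter ℕ) ≤ atTop := by
  rw [← Nat.cofinite_eq_atTop]; exact hyperfilter_le_cofinite

/-- Limit rays. -/
theorem aux_limit_ray [CAT0 X] [ProperSpace X] (o : X) (x : ℕ → X)
    (hx : Tendsto (fun n => dist o (x n)) atTop atTop) :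
    ∃ (r : Ray X) (g : ℕ → ℝ → X), r.1 0 = o ∧ (∀ n, GeodesicBetween (g n) o (x n)) ∧
      ∀ s, 0 ≤ s → Tendsto (fun n => g n s) (hyperfilter ℕ : Filter ℕ) (nhds (r.1 s)) := by
  choose g hg using fun n => CAT0.geodesic o (x n)
  have ev : ∀ s : ℝ, ∀ᶠ n in (hyperfilter ℕ : Filter ℕ), s ≤ dist o (x n) := fun s =>
    (hx.eventually_ge_atTop s).filter_mono aux_hyper_le
  have ex : ∀ s : ℝ, ∃ y, 0 ≤ s → Tendsto (fun n => g n s) (hyperfilter ℕ : Filter ℕ) (nhds y) := by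
    intro s
    by_cases hs : 0 ≤ s
    · obtain ⟨y, hy⟩ := aux_ulim o s (fun n => g n s) (by
        filter_upwards [ev s] with n hn
        have h1 := (hg n).2.2 s ⟨hs, hn⟩ 0 ⟨le_rfl, dist_nonneg⟩
        rw [(hg n).1, sub_zero, abs_of_nonneg hs] at h1
        exact h1.le)
      exact ⟨y, fun _ => hy⟩
    · exact ⟨o, fun h => absurd h hs⟩
  choose r hr using ex
  have hray : IsGeodesicRay r := by
    intro s t hs ht
    refine tendsto_nhds_unique ((hr s hs).dist (hr t ht)) (tendsto_const_nhds.congr' ?_)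
    filter_upwards [ev s, ev t] with n h1 h2
    exact ((hg n).2.2 s ⟨hs, h1⟩ t ⟨ht, h2⟩).symm
  refine ⟨⟨r, hray⟩, g, ?_, hg, hr⟩
  refine tendsto_nhds_unique (hr 0 le_rfl) (tendsto_const_nhds.congr ?_)
  intro n; exact (hg n).1.symm

theorem aux_ray_on (c : Ray X) (b : ℝ) : IsGeodesicOn c.1 0 b :=
  fun s hs t ht => c.2 s t hs.1 ht.1

theorem aux_ray_dist0 (c : Ray X) (t : ℝ) (ht : 0 ≤ t) : dist (c.1 0) (c.1 t) = t := by
  rw [c.2 0 t le_rfl ht, zero_sub, abs_neg, abs_of_nonneg ht]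

theorem aux_dist_far (c : Ray X) (p : X) :
    Tendsto (fun n : ℕ => dist p (c.1 n)) atTop atTop := by
  refine tendsto_atTop_mono (f := fun n : ℕ => (n : ℝ) + (-dist p (c.1 0))) ?_
    (tendsto_atTop_add_const_right _ _ tendsto_natCast_atTop_atTop)
  intro n
  have := dist_triangle (c.1 0) p (c.1 n)
  rw [aux_ray_dist0 c n (Nat.cast_nonneg n), dist_comm (c.1 0) p] at this
  linarith

/-- Asymptotic rays from arbitrary base points. -/
theorem aux_asym_ray [CAT0 X] [ProperSpace X] (c : Ray X) (p : X) :
    ∃ (r : Ray X) (g : ℕ → ℝ → X), r.1 0 = p ∧ rayClass r = rayClass c ∧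
      (∀ n : ℕ, GeodesicBetween (g n) p (c.1 n)) ∧
      ∀ s, 0 ≤ s → Tendsto (fun n => g n s) (hyperfilter ℕ : Filter ℕ) (nhds (r.1 s)) := by
  obtain ⟨r, g, h0, hg, hlim⟩ := aux_limit_ray p (fun n : ℕ => c.1 n) (aux_dist_far c p)
  refine ⟨r, g, h0, ?_, hg, hlim⟩
  refine Quotient.sound (s := raySetoid X) ⟨2 * dist p (c.1 0), fun s hs => ?_⟩
  refine le_of_tendsto ((hlim s hs).dist tendsto_const_nhds) ?_
  have ev : ∀ᶠ n : ℕ in (hyperfilter ℕ : Filter ℕ), s + 1 ≤ dist p (c.1 n) :=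
    ((aux_dist_far c p).eventually_ge_atTop (s + 1)).filter_mono aux_hyper_le
  have ev2 : ∀ᶠ n : ℕ in (hyperfilter ℕ : Filter ℕ), 1 ≤ n :=
    (eventually_ge_atTop 1).filter_mono aux_hyper_le
  filter_upwards [ev, ev2] with n hn hn1
  obtain ⟨e0, e1, e2⟩ := hg n
  have hn0 : (0 : ℝ) < n := by exact_mod_cast hn1
  set D := dist p (c.1 n) with hD
  have hD0 : 0 < D := by linarith
  have hDn : |(n : ℝ) - D| ≤ dist p (c.1 0) := by
    have t1 := dist_triangle (c.1 0) p (c.1 n)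
    have t2 := dist_triangle p (c.1 0) (c.1 n)
    rw [aux_ray_dist0 c n hn0.le] at t1 t2
    rw [dist_comm (c.1 0) p] at t1
    rw [abs_le]; constructor <;> linarith
  set l := s / D with hl
  have hl0 : 0 ≤ l := by positivity
  have hl1 : l ≤ 1 := by rw [hl, div_le_one hD0]; linarith
  have hlD : l * D = s := by rw [hl]; field_simp
  have key := aux_hinge_prop (fun t => g n (D - t)) (fun t => c.1 (n - t)) D n hD0 hn0
    (by
      intro u hu v hv
      rw [e2 (D - u) ⟨by linarith [hu.2], by linarith [hu.1]⟩ (D - v)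
        ⟨by linarith [hv.2], by linarith [hv.1]⟩, abs_sub_comm]
      congr 1; ring)
    (by
      intro u hu v hv
      rw [c.2 (n - u) (n - v) (by linarith [hu.2]) (by linarith [hv.2]), abs_sub_comm]
      congr 1; ring)
    (by simp [e1]) (1 - l) (by linarith) (by linarith)
  simp only [sub_self, e0] at key
  rw [show D - (1 - l) * D = s by rw [← hlD]; ring,
    show (n : ℝ) - (1 - l) * n = l * n by ring] at key
  have h2 : dist (c.1 (l * n)) (c.1 s) ≤ dist p (c.1 0) := by
    rw [c.2 _ _ (by positivity) hs]
    nth_rewrite 1 [← hlD]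
    rw [← mul_sub, abs_mul, abs_of_nonneg hl0]
    nlinarith [abs_nonneg ((n : ℝ) - D)]
  have h3 := dist_triangle (g n s) (c.1 (l * n)) (c.1 s)
  have h4 : (1 - l) * dist p (c.1 0) ≤ dist p (c.1 0) := by
    nlinarith [dist_nonneg (x := p) (y := c.1 0)]
  linarith

/-- Rays extend to lines. -/
theorem aux_extend_ray [CAT0 X] [ProperSpace X] (hgc : GeodesicallyComplete X) (r : Ray X) :
    ∃ L : ℝ → X, IsGeodesicLine L ∧ ∀ t, 0 ≤ t → L t = r.1 t := by
  have h : ∀ n : ℕ, ∃ L : ℝ → X, IsGeodesicLine L ∧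
      ∀ t ∈ Set.Icc (0 : ℝ) (n + 1), L t = r.1 t := by
    intro n
    have hn : (0 : ℝ) < n + 1 := by positivity
    have hd := aux_ray_dist0 r (n + 1) hn.le
    obtain ⟨L, hL, hLr⟩ := hgc r.1 (r.1 0) (r.1 (n + 1)) ⟨rfl, by rw [hd], aux_ray_on r _⟩ (by
      intro e
      rw [← e, dist_self] at hd
      linarith)
    rw [hd] at hLr
    exact ⟨L, hL, hLr⟩
  choose L hL hLr using h
  have ex : ∀ s : ℝ, ∃ y, Tendsto (fun n => L n s) (hyperfilter ℕ : Filter ℕ) (nhds y) := by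
    intro s
    refine aux_ulim (r.1 0) |s| _ (Eventually.of_forall fun n => ?_)
    rw [← hLr n 0 ⟨le_rfl, by positivity⟩, hL n, sub_zero]
  choose M hM using ex
  refine ⟨M, fun s t => ?_, fun t ht => ?_⟩
  · refine tendsto_nhds_unique ((hM s).dist (hM t)) (tendsto_const_nhds.congr ?_)
    intro n; exact (hL n s t).symm
  · refine tendsto_nhds_unique (hM t) (tendsto_const_nhds.congr' ?_)
    have : ∀ᶠ n : ℕ in atTop, t ≤ (n : ℝ) :=
      tendsto_natCast_atTop_atTop.eventually_ge_atTop t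
    filter_upwards [this.filter_mono aux_hyper_le] with n hn
    exact (hLr n t ⟨ht, by linarith⟩).symm

/-- Comparison along a ray towards an ideal point. -/
theorem aux_ray_est [CAT0 X] [ProperSpace X] (c : Ray X) (p : X) (R a : ℝ) (hR : 0 < R)
    (ha0 : 0 ≤ a) (ha1 : a ≤ 1) (hp : dist (c.1 0) p = R)
    (h : 2 * R ^ 2 * (1 + a) ≤ dist p (c.1 R) ^ 2) :
    ∃ r : Ray X, r.1 0 = p ∧ rayClass r = rayClass c ∧
      ∀ s, 0 ≤ s → dist (c.1 0) (r.1 s) ^ 2 ≤ R ^ 2 + s ^ 2 - 2 * a * R * s := by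
  obtain ⟨r, g, h0, hr, hg, hlim⟩ := aux_asym_ray c p
  refine ⟨r, h0, hr, fun s hs => ?_⟩
  refine le_of_tendsto ((tendsto_const_nhds.dist (hlim s hs)).pow 2) ?_
  have ev : ∀ᶠ n : ℕ in (hyperfilter ℕ : Filter ℕ), s + 1 ≤ dist p (c.1 n) :=
    ((aux_dist_far c p).eventually_ge_atTop (s + 1)).filter_mono aux_hyper_le
  have ev2 : ∀ᶠ n : ℕ in (hyperfilter ℕ : Filter ℕ), R ≤ (n : ℝ) :=
    (tendsto_natCast_atTop_atTop.eventually_ge_atTop R).filter_mono aux_hyper_le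
  filter_upwards [ev, ev2] with n hn hn1
  obtain ⟨e0, e1, e2⟩ := hg n
  have hn0 : (0 : ℝ) < n := by linarith
  have m1 := aux_cat0_ineq c.1 n (aux_ray_on c n) p R ⟨hR.le, hn1⟩
  have m2 := aux_cat0_ineq (g n) _ e2 (c.1 0) s ⟨hs, by linarith⟩
  rw [e1, e0, aux_ray_dist0 c n hn0.le, hp] at m2
  rw [dist_comm p (c.1 0), hp] at m1
  have tri := dist_triangle p (c.1 0) (c.1 n)
  rw [dist_comm p (c.1 0), hp, aux_ray_dist0 c n hn0.le] at tri
  generalize dist p (c.1 n) = D at *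
  generalize dist (c.1 0) (g n s) = E at *
  have hD0 : 0 < D := by linarith
  have k1 : R * (R ^ 2 + n ^ 2 - D ^ 2) ≤ R * (-(2 * a * R * n)) := by nlinarith
  have k1' := le_of_mul_le_mul_left k1 hR
  have k2 : 2 * a * R * D ≤ R ^ 2 + D ^ 2 - n ^ 2 := by
    have q1 : a * D ≤ a * (R + n) := by gcongr
    have q2 : a * R ≤ 1 * R := by gcongr
    have q3 : a * D ≤ R + a * n := by linarith
    have := mul_le_mul_of_nonneg_left q3 hR.le
    nlinarith
  have k3 := mul_le_mul_of_nonneg_left k2 hs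
  have k4 : D * E ^ 2 ≤ D * (R ^ 2 + s ^ 2 - 2 * a * R * s) := by nlinarith
  exact le_of_mul_le_mul_left k4 hD0

theorem aux_back_est [CAT0 X] [ProperSpace X] (o : X) (L : ℝ → X) (hL : IsGeodesicLine L)
    (R a : ℝ) (hR : 0 < R) (ha0 : 0 ≤ a) (ha1 : a ≤ 1)
    (h : ∀ s, 0 ≤ s → dist o (L s) ^ 2 ≤ R ^ 2 + s ^ 2 - 2 * a * R * s)
    (u : ℝ) (hu : 0 ≤ u) : u + a * R ≤ dist o (L (-u)) := by
  by_contra! hlt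
  set w := dist o (L (-u)) - u with hw
  have hwa : 0 < a * R - w := by linarith
  set s := max (max w 0) ((R ^ 2 + 1) / (2 * (a * R - w))) with hs
  have hs0 : 0 ≤ s := (le_max_right _ _).trans (le_max_left _ _)
  have hsw : w ≤ s := (le_max_left _ _).trans (le_max_left _ _)
  have hs2 : (R ^ 2 + 1) / (2 * (a * R - w)) ≤ s := le_max_right _ _
  rw [div_le_iff₀ (by positivity)] at hs2
  have tri := dist_triangle (L (-u)) o (L s)
  rw [hL (-u) s, dist_comm _ o, show -u - s = -(u + s) by ring, abs_neg,
    abs_of_nonneg (by positivity)] at tri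
  have h1 : s - w ≤ dist o (L s) := by linarith
  have h2 : (s - w) ^ 2 ≤ dist o (L s) ^ 2 := by
    have : 0 ≤ s - w := by linarith
    gcongr
  nlinarith [h s hs0, sq_nonneg w]

theorem aux_key [CAT0 X] [ProperSpace X] (hgc : GeodesicallyComplete X)
    (A : Set (IdealBoundary X)) (hA : VisuallySymmetricSet A) (c d : Ray X) (R a : ℝ)
    (h0 : c.1 0 = d.1 0) (hc : rayClass c ∈ A) (hR : 0 < R)
    (ha0 : 0 ≤ a) (ha1 : a ≤ 1) (h : 2 * R ^ 2 * (1 + a) ≤ dist (d.1 R) (c.1 R) ^ 2) :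
    ∃ e : Ray X, rayClass e ∈ A ∧ e.1 0 = d.1 0 ∧
      ∀ t, 0 ≤ t → t ≤ R → dist (e.1 t) (d.1 t) ^ 2 ≤ 2 * (1 - a) * t ^ 2 := by
  obtain ⟨r, hr0, hrc, hr⟩ := aux_ray_est c (d.1 R) R a hR ha0 ha1
    (by rw [h0]; exact aux_ray_dist0 d R hR.le) h
  obtain ⟨L, hL, hLr⟩ := aux_extend_ray hgc r
  have hpos : rayClass (linePosRay L hL) = rayClass c := by
    rw [← hrc]
    refine Quotient.sound (s := raySetoid X) ⟨0, fun t ht => ?_⟩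
    have : dist (L t) (r.1 t) ≤ 0 := by rw [hLr t ht, dist_self]
    exact this
  have hneg : rayClass (lineNegRay L hL) ∈ A := hA _ hc _ ⟨L, hL, hpos, rfl⟩
  obtain ⟨e, g, he0, hec, hg, hlim⟩ := aux_asym_ray (lineNegRay L hL) (d.1 0)
  refine ⟨e, hec ▸ hneg, he0, fun t ht htR => ?_⟩
  refine le_of_tendsto (((hlim t ht).dist tendsto_const_nhds).pow 2) ?_
  have ev : ∀ᶠ n : ℕ in (hyperfilter ℕ : Filter ℕ),
      t + 1 ≤ dist (d.1 0) ((lineNegRay L hL).1 n) :=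
    ((aux_dist_far _ _).eventually_ge_atTop (t + 1)).filter_mono aux_hyper_le
  filter_upwards [ev] with n hn
  have hgn : GeodesicBetween (g n) (d.1 0) (L (-n)) := hg n
  obtain ⟨e0, e1, e2⟩ := hgn
  have hn : t + 1 ≤ dist (d.1 0) (L (-n)) := hn
  have back := aux_back_est (d.1 0) L hL R a hR ha0 ha1
    (fun s hs => by rw [hLr s hs, ← h0]; exact hr s hs) n (Nat.cast_nonneg n)
  have hpn : dist (L (-n)) (d.1 R) = n := by
    rw [← hr0, ← hLr 0 le_rfl, hL]; simp
  have tri := dist_triangle (d.1 0) (d.1 R) (L (-n))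
  rw [dist_comm (d.1 R), hpn, aux_ray_dist0 d R hR.le] at tri
  have hin := aux_hinge (g n) d.1 _ R e2 (aux_ray_on d R) e0 t t ⟨ht, by linarith⟩ ⟨ht, htR⟩
  rw [e1, hpn] at hin
  generalize dist (d.1 0) (L (-n)) = D at *
  generalize dist (g n t) (d.1 t) = E at *
  have hD0 : 0 < D := by linarith
  have hn0 : (0 : ℝ) ≤ n := Nat.cast_nonneg n
  have k1 : 2 * a * R * D ≤ D ^ 2 + R ^ 2 - n ^ 2 := by
    have q1 : a * R * (2 * D - R) ≤ (D - n) * (D + n) := by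
      have haR : 0 ≤ a * R := by positivity
      calc a * R * (2 * D - R) ≤ a * R * (D + n) := by gcongr; linarith
        _ ≤ (D - n) * (D + n) := by gcongr; linarith
    have q2 : a * R ^ 2 ≤ 1 * R ^ 2 := by gcongr
    nlinarith
  have k2 := mul_le_mul_of_nonneg_left k1 (mul_nonneg ht ht)
  have k3 : (D * R) * E ^ 2 ≤ (D * R) * (2 * (1 - a) * t ^ 2) := by nlinarith
  exact le_of_mul_le_mul_left k3 (by positivity)

theorem aux_limit_exists [CAT0 X] (c d : Ray X) (h0 : c.1 0 = d.1 0) :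
    ∃ l : ℝ, 0 ≤ l ∧ l ≤ 2 ∧ Tendsto (fun t : ℝ => dist (c.1 t) (d.1 t) / t) atTop (nhds l) ∧
      ∀ t, 0 ≤ t → dist (c.1 t) (d.1 t) ≤ l * t := by
  have mono : ∀ s t : ℝ, 0 < s → s ≤ t →
      dist (c.1 s) (d.1 s) / s ≤ dist (c.1 t) (d.1 t) / t := by
    intro s t hs hst
    have ht : 0 < t := by linarith
    have := aux_hinge_prop c.1 d.1 t t ht ht (aux_ray_on c t) (aux_ray_on d t) h0 (s / t)
      (by positivity) (by rw [div_le_one ht]; exact hst)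
    rw [div_mul_cancel₀ _ ht.ne'] at this
    rw [div_le_iff₀ hs]
    calc _ ≤ _ := this
      _ = _ := by ring
  have bd : ∀ t : ℝ, 0 < t → dist (c.1 t) (d.1 t) / t ≤ 2 := by
    intro t ht
    rw [div_le_iff₀ ht]
    have := dist_triangle (c.1 t) (c.1 0) (d.1 t)
    rw [dist_comm (c.1 t) (c.1 0), aux_ray_dist0 c t ht.le, h0, aux_ray_dist0 d t ht.le] at this
    linarith
  set f : ℝ → ℝ := fun t => dist (c.1 (max t 1)) (d.1 (max t 1)) / max t 1 with hf
  have hfm : Monotone f := by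
    intro s t hst
    exact mono _ _ (by positivity) (max_le_max hst le_rfl)
  have hfb : BddAbove (Set.range f) := ⟨2, by
    rintro _ ⟨t, rfl⟩
    exact bd _ (by positivity)⟩
  have hlim := tendsto_atTop_ciSup hfm hfb
  have hlim2 : Tendsto (fun t : ℝ => dist (c.1 t) (d.1 t) / t) atTop (nhds (⨆ t, f t)) := by
    refine hlim.congr' ?_
    filter_upwards [eventually_ge_atTop 1] with t ht
    simp only [hf, max_eq_left ht]
  refine ⟨_, ?_, ?_, hlim2, ?_⟩
  · refine ge_of_tendsto hlim2 ?_
    filter_upwards [eventually_gt_atTop 0] with t ht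
    positivity
  · refine le_of_tendsto hlim2 ?_
    filter_upwards [eventually_gt_atTop 0] with t ht
    exact bd t ht
  · intro t ht
    rcases ht.eq_or_lt with rfl | ht
    · simp [h0]
    · rw [← div_le_iff₀ ht]
      refine ge_of_tendsto hlim2 ?_
      filter_upwards [eventually_ge_atTop t] with s hs
      exact mono t s ht hs

theorem aux_titsAngle (c d : Ray X) (h0 : c.1 0 = d.1 0) (l : ℝ)
    (hl : Tendsto (fun t : ℝ => dist (c.1 t) (d.1 t) / t) atTop (nhds l)) :
    titsAngle (rayClass c) (rayClass d) = 2 * Real.arcsin (l / 2) := by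
  have gen : ∀ c' d' : Ray X, rayClass c' = rayClass c → rayClass d' = rayClass d →
      Tendsto (fun t : ℝ => 2 * Real.arcsin (dist (c'.1 t) (d'.1 t) / (2 * t)))
        atTop (nhds (2 * Real.arcsin (l / 2))) := by
    intro c' d' hc hd
    obtain ⟨K, hK⟩ : asymptotic c' c := Quotient.exact (s := raySetoid X) hc
    obtain ⟨K', hK'⟩ : asymptotic d' d := Quotient.exact (s := raySetoid X) hd
    have hz : Tendsto (fun t : ℝ => (K + K') / t) atTop (nhds 0) :=
      tendsto_const_nhds.div_atTop tendsto_id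
    have hdiff : Tendsto (fun t : ℝ => dist (c'.1 t) (d'.1 t) / t - dist (c.1 t) (d.1 t) / t)
        atTop (nhds 0) := by
      refine squeeze_zero_norm' ?_ hz
      filter_upwards [eventually_gt_atTop 0] with t ht
      rw [← sub_div, norm_div, Real.norm_eq_abs, Real.norm_eq_abs, abs_of_pos ht]
      gcongr
      have a1 := hK t ht.le
      have a2 := hK' t ht.le
      have b1 := dist_triangle4 (c'.1 t) (c.1 t) (d.1 t) (d'.1 t)
      have b2 := dist_triangle4 (c.1 t) (c'.1 t) (d'.1 t) (d.1 t)
      rw [dist_comm (d.1 t)] at b1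
      rw [dist_comm (c.1 t) (c'.1 t)] at b2
      rw [abs_le]; constructor <;> linarith
    have h1 : Tendsto (fun t : ℝ => dist (c'.1 t) (d'.1 t) / t) atTop (nhds l) := by
      have := hdiff.add hl
      simpa using this
    have h2 : Tendsto (fun t : ℝ => dist (c'.1 t) (d'.1 t) / (2 * t)) atTop (nhds (l / 2)) := by
      refine (h1.div_const 2).congr fun t => ?_
      rw [div_div, mul_comm]
    exact ((Real.continuous_arcsin.tendsto _).comp h2).const_mul 2
  have : {θ : ℝ | ∃ c' d' : Ray X, rayClass c' = rayClass c ∧ rayClass d' = rayClass d ∧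
      c'.1 0 = d'.1 0 ∧
      Tendsto (fun t : ℝ => 2 * Real.arcsin (dist (c'.1 t) (d'.1 t) / (2 * t)))
      atTop (nhds θ)} = {2 * Real.arcsin (l / 2)} := by
    ext θ
    constructor
    · rintro ⟨c', d', hc, hd, -, ht⟩
      exact tendsto_nhds_unique ht (gen c' d' hc hd)
    · rintro rfl
      exact ⟨c, d, rfl, rfl, h0, gen c d rfl rfl⟩
  rw [titsAngle, this, csSup_singleton]

theorem aux_angle_le [CAT0 X] (c d : Ray X) (h0 : c.1 0 = d.1 0) (θ : ℝ) (hθ0 : 0 ≤ θ)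
    (hθ : θ ≤ π) (h : ∀ t, 0 ≤ t → dist (c.1 t) (d.1 t) ≤ 2 * Real.sin (θ / 2) * t) :
    titsAngle (rayClass c) (rayClass d) ≤ θ := by
  obtain ⟨l, hl0, hl2, hl, -⟩ := aux_limit_exists c d h0
  rw [aux_titsAngle c d h0 l hl]
  have h1 : l ≤ 2 * Real.sin (θ / 2) := by
    refine le_of_tendsto hl ?_
    filter_upwards [eventually_gt_atTop 0] with t ht
    rw [div_le_iff₀ ht]
    exact h t ht.le
  have h2 : Real.arcsin (l / 2) ≤ θ / 2 := by
    rw [← Real.arcsin_sin (x := θ / 2) (by linarith [Real.pi_pos]) (by linarith)]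
    exact Real.monotone_arcsin (by linarith)
  linarith

/-- Hinge bound used for Tits midpoints. -/
theorem aux_mid_bound [CAT0 X] (c : Ray X) (m : X) (g : ℝ → X) (T k : ℝ) (hT : 0 < T)
    (hk : 0 ≤ k) (hg : GeodesicBetween g (c.1 0) m) (hm : 0 < dist (c.1 0) m)
    (hcm : dist m (c.1 T) ^ 2 ≤ T ^ 2 * (1 - k ^ 2))
    (s : ℝ) (hs : 0 ≤ s) (hsT : s ≤ T) (hsm : s ≤ dist (c.1 0) m) :
    dist (c.1 s) (g s) ^ 2 ≤ 2 * (1 - k) * s ^ 2 := by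
  obtain ⟨e0, e1, e2⟩ := hg
  have hin := aux_hinge g c.1 _ T e2 (aux_ray_on c T) e0 s s ⟨hs, hsm⟩ ⟨hs, hsT⟩
  rw [e1, dist_comm (g s)] at hin
  generalize dist (c.1 0) m = D at *
  generalize dist (c.1 s) (g s) = E at *
  have k1 : 2 * k * D * T ≤ D ^ 2 + T ^ 2 - dist m (c.1 T) ^ 2 := by
    nlinarith [sq_nonneg (D - k * T)]
  have k2 := mul_le_mul_of_nonneg_left k1 (mul_nonneg hs hs)
  have k3 : (D * T) * E ^ 2 ≤ (D * T) * (2 * (1 - k) * s ^ 2) := by nlinarith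
  exact le_of_mul_le_mul_left k3 (by positivity)

theorem aux_midpoint [CAT0 X] [ProperSpace X] (c d : Ray X) (h0 : c.1 0 = d.1 0) (θ : ℝ)
    (hθ0 : 0 ≤ θ) (hθ : θ < π)
    (h : ∀ t, 0 ≤ t → dist (c.1 t) (d.1 t) ≤ 2 * Real.sin (θ / 2) * t) :
    ∃ e : Ray X, e.1 0 = c.1 0 ∧
      (∀ t, 0 ≤ t → dist (c.1 t) (e.1 t) ≤ 2 * Real.sin (θ / 2 / 2) * t) ∧
      (∀ t, 0 ≤ t → dist (e.1 t) (d.1 t) ≤ 2 * Real.sin (θ / 2 / 2) * t) := by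
  have hpi := Real.pi_pos
  -- midpoints
  have hmid : ∀ x y : X, ∃ m, dist m x = dist x y / 2 ∧ dist m y = dist x y / 2 := by
    intro x y
    obtain ⟨g, e0, e1, e2⟩ := CAT0.geodesic x y
    have hD : 0 ≤ dist x y := dist_nonneg
    have hm : dist x y / 2 ∈ Set.Icc 0 (dist x y) := ⟨by linarith, by linarith⟩
    refine ⟨g (dist x y / 2), ?_, ?_⟩
    · have := e2 _ hm 0 ⟨le_rfl, hD⟩
      rwa [e0, sub_zero, abs_of_nonneg hm.1] at this
    · have := e2 _ hm _ ⟨hD, le_rfl⟩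
      rw [e1] at this
      rw [this, show dist x y / 2 - dist x y = -(dist x y / 2) by ring, abs_neg,
        abs_of_nonneg hm.1]
  choose m hm1 hm2 using fun n : ℕ => hmid (c.1 n) (d.1 n)
  have hsin1 : Real.sin (θ / 2) < 1 := by
    rw [← Real.sin_pi_div_two]
    exact Real.sin_lt_sin_of_lt_of_le_pi_div_two (by linarith) (by linarith) (by linarith)
  have hsin0 : 0 ≤ Real.sin (θ / 2) := Real.sin_nonneg_of_nonneg_of_le_pi (by linarith) (by linarith)
  have hcos0 : 0 ≤ Real.cos (θ / 2) :=
    Real.cos_nonneg_of_neg_pi_div_two_le_of_le (by linarith) (by linarith)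
  have hlow : ∀ n : ℕ, (1 - Real.sin (θ / 2)) * n ≤ dist (c.1 0) (m n) := by
    intro n
    have t1 := dist_triangle (c.1 0) (m n) (c.1 n)
    rw [aux_ray_dist0 c n (Nat.cast_nonneg n), hm1] at t1
    have := h n (Nat.cast_nonneg n)
    linarith
  have hfar : Tendsto (fun n : ℕ => dist (c.1 0) (m n)) atTop atTop :=
    tendsto_atTop_mono hlow (tendsto_natCast_atTop_atTop.const_mul_atTop (by linarith))
  obtain ⟨e, g, he0, hg, hlim⟩ := aux_limit_ray (c.1 0) m hfar
  have hhalf : 1 - Real.cos (θ / 2) = 2 * Real.sin (θ / 2 / 2) ^ 2 := by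
    have h1 := Real.cos_sq' (θ / 2 / 2)
    have h2 := Real.cos_two_mul (θ / 2 / 2)
    rw [show 2 * (θ / 2 / 2) = θ / 2 by ring] at h2
    linarith
  have hs4 : 0 ≤ Real.sin (θ / 2 / 2) :=
    Real.sin_nonneg_of_nonneg_of_le_pi (by linarith) (by linarith)
  have hd2 : ∀ n : ℕ, (dist (c.1 n) (d.1 n) / 2) ^ 2 ≤ (n : ℝ) ^ 2 * (1 - Real.cos (θ / 2) ^ 2) := by
    intro n
    have h1 : dist (c.1 n) (d.1 n) / 2 ≤ Real.sin (θ / 2) * n := by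
      linarith [h n (Nat.cast_nonneg n)]
    have h2 : (dist (c.1 n) (d.1 n) / 2) ^ 2 ≤ (Real.sin (θ / 2) * n) ^ 2 := by gcongr
    rw [← Real.sin_sq]
    linarith
  have ev : ∀ s : ℝ, ∀ᶠ n : ℕ in (hyperfilter ℕ : Filter ℕ), s + 1 ≤ dist (c.1 0) (m n) := fun s =>
    (hfar.eventually_ge_atTop (s + 1)).filter_mono aux_hyper_le
  have ev2 : ∀ s : ℝ, ∀ᶠ n : ℕ in (hyperfilter ℕ : Filter ℕ), s + 1 ≤ (n : ℝ) := fun s =>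
    (tendsto_natCast_atTop_atTop.eventually_ge_atTop (s + 1)).filter_mono aux_hyper_le
  have fin : ∀ (f : Ray X), f.1 0 = c.1 0 →
      (∀ n : ℕ, dist (m n) (f.1 n) = dist (c.1 n) (d.1 n) / 2) →
      ∀ t, 0 ≤ t → dist (f.1 t) (e.1 t) ≤ 2 * Real.sin (θ / 2 / 2) * t := by
    intro f hf0 hf t ht
    refine le_of_sq_le_sq ?_ (by positivity)
    refine le_of_tendsto ((tendsto_const_nhds.dist (hlim t ht)).pow 2) ?_
    filter_upwards [ev t, ev2 t] with n hn1 hn2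
    have := aux_mid_bound f (m n) (g n) n (Real.cos (θ / 2)) (by linarith) hcos0
      (by rw [hf0]; exact hg n) (by rw [hf0]; linarith) (by rw [hf]; exact hd2 n)
      t ht (by linarith) (by rw [hf0]; linarith)
    rw [hhalf] at this
    linarith
  refine ⟨e, he0, fin c rfl hm1, fun t ht => ?_⟩
  rw [dist_comm]
  exact fin d h0.symm hm2 t ht

theorem aux_chain [CAT0 X] [ProperSpace X] (n : ℕ) : ∀ (c d : Ray X) (_ : c.1 0 = d.1 0) (θ : ℝ)
    (_ : 0 ≤ θ) (_ : θ < π)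
    (_ : ∀ t, 0 ≤ t → dist (c.1 t) (d.1 t) ≤ 2 * Real.sin (θ / 2) * t),
    ∃ f : ℕ → IdealBoundary X, f 0 = rayClass c ∧ f (2 ^ n) = rayClass d ∧
      ∀ i < 2 ^ n, titsAngle (f i) (f (i + 1)) ≤ θ / 2 ^ n := by
  induction n with
  | zero =>
    intro c d h0 θ hθ0 hθ h
    refine ⟨fun i => if i = 0 then rayClass c else rayClass d, by simp, by simp, ?_⟩
    intro i hi
    obtain rfl : i = 0 := by simpa using hi
    simpa using aux_angle_le c d h0 θ hθ0 hθ.le h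
  | succ n ih =>
    intro c d h0 θ hθ0 hθ h
    obtain ⟨e, he0, h1, h2⟩ := aux_midpoint c d h0 θ hθ0 hθ h
    obtain ⟨f1, a1, b1, s1⟩ := ih c e he0.symm (θ / 2) (by linarith) (by linarith) h1
    obtain ⟨f2, a2, b2, s2⟩ := ih e d (he0.trans h0) (θ / 2) (by linarith) (by linarith) h2
    have hp : 0 < 2 ^ n := by positivity
    have ed : θ / 2 ^ (n + 1) = θ / 2 / 2 ^ n := by rw [pow_succ]; field_simp
    refine ⟨fun i => if i ≤ 2 ^ n then f1 i else f2 (i - 2 ^ n), by simp [a1], ?_, ?_⟩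
    · have : ¬ (2 ^ (n + 1) ≤ 2 ^ n) := by rw [pow_succ]; omega
      simp only [this, if_false]
      rw [show 2 ^ (n + 1) - 2 ^ n = 2 ^ n by rw [pow_succ]; omega, b2]
    · intro i hi
      rw [ed]
      rw [pow_succ] at hi
      rcases lt_trichotomy i (2 ^ n) with hlt | heq | hgt
      · have q1 : i ≤ 2 ^ n := hlt.le
        have q2 : i + 1 ≤ 2 ^ n := hlt
        simp only [q1, q2, if_true]
        exact s1 i hlt
      · have q2 : ¬ (2 ^ n + 1 ≤ 2 ^ n) := by omega
        subst heq
        simp only [q2, le_refl, if_true, if_false]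
        rw [b1, ← a2, show 2 ^ n + 1 - 2 ^ n = 0 + 1 by omega]
        exact s2 0 hp
      · have q1 : ¬ (i ≤ 2 ^ n) := by omega
        have q2 : ¬ (i + 1 ≤ 2 ^ n) := by omega
        simp only [q1, q2, if_false]
        rw [show i + 1 - 2 ^ n = (i - 2 ^ n) + 1 by omega]
        exact s2 _ (by omega)

theorem aux_titsDist_le [CAT0 X] [ProperSpace X] (c d : Ray X) (h0 : c.1 0 = d.1 0) (θ : ℝ)
    (hθ0 : 0 ≤ θ) (hθ : θ < π)
    (h : ∀ t, 0 ≤ t → dist (c.1 t) (d.1 t) ≤ 2 * Real.sin (θ / 2) * t) :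
    titsDist (rayClass c) (rayClass d) ≤ ENNReal.ofReal θ := by
  refine iSup₂_le fun ε hε => ?_
  obtain ⟨n, hn⟩ : ∃ n : ℕ, θ / 2 ^ n ≤ ε := by
    obtain ⟨n, hn⟩ := pow_unbounded_of_one_lt (θ / ε) (one_lt_two (α := ℝ))
    refine ⟨n, ?_⟩
    rw [div_lt_iff₀ hε] at hn
    rw [div_le_iff₀ (by positivity)]
    linarith
  obtain ⟨f, f0, f1, hf⟩ := aux_chain n c d h0 θ hθ0 hθ h
  refine le_trans (b := chainLength f (2 ^ n))
    (sInf_le ⟨2 ^ n, f, f0, f1, fun i hi => (hf i hi).trans hn, rfl⟩) ?_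
  unfold chainLength
  calc _ ≤ ∑ i ∈ Finset.range (2 ^ n), ENNReal.ofReal (θ / 2 ^ n) :=
        Finset.sum_le_sum fun i hi => ENNReal.ofReal_le_ofReal (hf i (Finset.mem_range.1 hi))
    _ = ENNReal.ofReal θ := by
        rw [← ENNReal.ofReal_sum_of_nonneg (fun _ _ => by positivity)]
        congr 1
        simp
        field_simp

theorem aux_antipodal [CAT0 X] [ProperSpace X] (c d : Ray X) (h0 : c.1 0 = d.1 0)
    (h : AntipodalB (rayClass c) (rayClass d)) :
    Tendsto (fun t : ℝ => dist (c.1 t) (d.1 t) / t) atTop (nhds 2) := by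
  obtain ⟨l, hl0, hl2, hl, hb⟩ := aux_limit_exists c d h0
  rcases hl2.eq_or_lt with rfl | hlt
  · exact hl
  exfalso
  have hθ : 2 * Real.arcsin (l / 2) < π := by
    have : Real.arcsin (l / 2) < π / 2 := Real.arcsin_lt_pi_div_two.2 (by linarith)
    linarith
  have hθ0 : 0 ≤ 2 * Real.arcsin (l / 2) := by
    have : 0 ≤ Real.arcsin (l / 2) := Real.arcsin_nonneg.2 (by linarith)
    linarith
  have := aux_titsDist_le c d h0 (2 * Real.arcsin (l / 2)) hθ0 hθ (by
    intro t ht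
    rw [mul_div_cancel_left₀ _ (two_ne_zero), Real.sin_arcsin (by linarith) (by linarith)]
    linarith [hb t ht])
  have h2 : ENNReal.ofReal π ≤ ENNReal.ofReal (2 * Real.arcsin (l / 2)) := h.trans this
  rw [ENNReal.ofReal_le_ofReal_iff hθ0] at h2
  linarith

/-- The closure (in the cone topology) of a visually symmetric subset of the ideal
boundary of a locally compact, geodesically complete CAT(0) space is symmetric: it
contains all Tits antipodes of its points. -/
theorem closure_of_visually_symmetric_is_symmetric
    {X : Type*} [MetricSpace X] [CAT0 X] [LocallyCompactSpace X] [CompleteSpace X]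
    (hgc : GeodesicallyComplete X)
    (A : Set (IdealBoundary X)) (hA : VisuallySymmetricSet A) :
    SymmetricSet (coneClosure A) := by
  haveI : ProperSpace X := aux_proper
  intro ξ hξ η hη
  -- a sequence in `A` converging to `ξ`
  obtain ⟨c, c', hcA, hc', hc0, hconv⟩ : ∃ (c : ℕ → Ray X) (c' : Ray X),
      (∀ k, rayClass (c k) ∈ A) ∧ rayClass c' = ξ ∧ (∀ k, (c k).1 0 = c'.1 0) ∧
      ∀ t : ℝ, 0 ≤ t → Tendsto (fun k => dist ((c k).1 t) (c'.1 t)) atTop (nhds 0) := by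
    rcases hξ with h | ⟨x, hx, c, c', h1, h2, h3, h4⟩
    · obtain ⟨c', hc'⟩ := Quotient.exists_rep ξ
      have hc2 : rayClass c' = ξ := hc'
      exact ⟨fun _ => c', c', fun _ => by rw [hc2]; exact h, hc2, fun _ => rfl, fun t _ => by simp⟩
    · exact ⟨c, c', fun k => by rw [h1]; exact hx k, h2, h3, h4⟩
  obtain ⟨d0, hd0⟩ := Quotient.exists_rep η
  obtain ⟨d, -, hd, hdc, -⟩ := aux_asym_ray d0 (c'.1 0)
  have hdη : rayClass d = η := hdc.trans hd0
  rw [← hc', ← hdη] at hη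
  have hlim := aux_antipodal c' d hd.symm hη
  have key : ∀ k : ℕ, ∃ e : Ray X, rayClass e ∈ A ∧ e.1 0 = d.1 0 ∧
      ∀ t : ℝ, 0 ≤ t → t ≤ k → dist (e.1 t) (d.1 t) ^ 2 ≤ 2 / ((k : ℝ) + 1) * t ^ 2 := by
    intro k
    have hk : (0 : ℝ) < (k : ℝ) + 1 := by positivity
    set δ : ℝ := 1 / ((k : ℝ) + 1) with hδ
    have hδ0 : 0 < δ := by positivity
    have hδ1 : δ ≤ 1 := by
      rw [hδ, div_le_one hk]
      linarith [Nat.cast_nonneg (α := ℝ) k]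
    have e1 : ∀ᶠ t : ℝ in atTop, 2 - δ / 2 < dist (c'.1 t) (d.1 t) / t :=
      hlim.eventually_const_lt (by linarith)
    obtain ⟨R, h1, h2⟩ := (e1.and (eventually_ge_atTop ((k : ℝ) + 1))).exists
    have hR : 0 < R := by linarith
    rw [lt_div_iff₀ hR] at h1
    have e2 : Tendsto (fun j => dist ((c j).1 R) (d.1 R)) atTop (nhds (dist (c'.1 R) (d.1 R))) := by
      have := hconv R hR.le
      exact (tendsto_iff_dist_tendsto_zero.2 this).dist tendsto_const_nhds
    obtain ⟨j, hj⟩ := (e2.eventually_const_lt h1).exists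
    obtain ⟨e, heA, he0, he⟩ := aux_key hgc A hA (c j) d R (1 - δ) ((hc0 j).trans hd.symm) (hcA j)
      hR (by linarith) (by linarith) (by
        rw [dist_comm]
        have h3 : ((2 - δ / 2) * R) ^ 2 ≤ dist ((c j).1 R) (d.1 R) ^ 2 := by
          have : 0 ≤ (2 - δ / 2) * R := mul_nonneg (by linarith) hR.le
          gcongr
        nlinarith [sq_nonneg (δ * R)])
    refine ⟨e, heA, he0, fun t ht htk => ?_⟩
    have := he t ht (by linarith)
    rw [show 2 / ((k : ℝ) + 1) = 2 * (1 - (1 - δ)) by rw [hδ]; ring]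
    exact this
  choose e heA he0 he using key
  refine Or.inr ⟨fun k => rayClass (e k), heA, e, d, fun _ => rfl, hdη, he0, fun t ht => ?_⟩
  have hz : Tendsto (fun k : ℕ => 2 / ((k : ℝ) + 1) * t ^ 2) atTop (nhds 0) := by
    have h1 : Tendsto (fun k : ℕ => 2 / ((k : ℝ) + 1)) atTop (nhds 0) :=
      tendsto_const_nhds.div_atTop
        (tendsto_atTop_add_const_right _ _ tendsto_natCast_atTop_atTop)
    simpa using h1.mul_const (t ^ 2)
  have hsq : Tendsto (fun k => dist ((e k).1 t) (d.1 t) ^ 2) atTop (nhds 0) := by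
    refine squeeze_zero' (Eventually.of_forall fun k => by positivity) ?_ hz
    filter_upwards [tendsto_natCast_atTop_atTop.eventually_ge_atTop t] with k hk
    exact he k t ht hk
  have := hsq.sqrt
  simpa [Real.sqrt_sq dist_nonneg] using this

end
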